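/- For all integers ℓ, k, d with d + 2 ≤ ℓ ≤ k and every real number p with 0 ≤ p < 1, one has (1−p)^{ℓ−2} + p·(1−p)^{ℓ−3}·(ℓ−d−2) ≥ (1−p)^{k−2} + p·(1−p)^{k−3}·(k−d−2). -/

import Mathlib

/-- For all integers `ℓ, k, d` with `d + 2 ≤ ℓ ≤ k` and every real `p ∈ [0,1)`,
`(1−p)^(ℓ−2) + p·(1−p)^(ℓ−3)·(ℓ−d−2) ≥ (1−p)^(k−2) + p·(1−p)^(k−3)·(k−d−2)`. -/
theorem zpow_dist_ineq (ℓ k d : ℤ) (hdl : d + 2 ≤ ℓ) (hlk : ℓ ≤ k)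
    (p : ℝ) (hp0 : 0 ≤ p) (hp1 : p < 1) :
    (1 - p) ^ (k - 2) + p * (1 - p) ^ (k - 3) * ((k - d - 2 : ℤ) : ℝ) ≤
      (1 - p) ^ (ℓ - 2) + p * (1 - p) ^ (ℓ - 3) * ((ℓ - d - 2 : ℤ) : ℝ) := by
  have hq : 0 < 1 - p := sub_pos.mpr hp1
  induction k, hlk using Int.leInduction with
  | base => exact le_rfl
  | succ m hm ih =>
    refine le_trans ?_ ih
    have h₁ : (1 - p) ^ (m + 1 - 2) = (1 - p) ^ (m - 3) * (1 - p) ^ 2 := by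
      rw [← zpow_natCast, ← zpow_add₀ hq.ne']
      congr 1
      push_cast
      ring
    have h₂ : (1 - p) ^ (m + 1 - 3) = (1 - p) ^ (m - 3) * (1 - p) := by
      rw [← zpow_add_one₀ hq.ne']
      congr 1
      ring
    have h₃ : (1 - p) ^ (m - 2) = (1 - p) ^ (m - 3) * (1 - p) := by
      rw [← zpow_add_one₀ hq.ne']
      congr 1
      ring
    have hx : (0 : ℝ) ≤ ((m - d - 2 : ℤ) : ℝ) := by
      exact_mod_cast (by lia : 0 ≤ m - d - 2)
    have hdiff : 0 ≤ (1 - p) ^ (m - 3) * (p ^ 2 * ((m - d - 2 : ℤ) : ℝ)) := by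
      positivity
    rw [h₁, h₂, h₃]
    push_cast at hdiff ⊢
    linear_combination hdiff
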